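/- arXiv:alg-geom/9705013 — 2 statements merged into one kernel-verified Lean document; each statement's English description precedes it below -/
import Mathlib

section
/- Let P = {p_1 < p_2 < ⋯} be an infinite subset of ℕ and let φ_P : S_∞ → S_∞ be the homomorphism with φ_P(ζ) fixing every element of ℕ ∖ P and φ_P(ζ)(p_i) = p_{ζ(i)}. Then φ_P is an injection of graded posets for the order ⪯: for all η, ζ ∈ S_∞, η ⪯ ζ if and only if φ_P(η) ⪯ φ_P(ζ), and the rank satisfies |φ_P(ζ)| = |ζ|, where |ξ| := ℓ(ξu) − ℓ(u) for any u ∈ S_∞ and k ∈ ℕ with u ≤_k ξu. -/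
/-- A permutation of the positive integers belongs to `S_∞` when it moves only
finitely many points. -/
def FinSupp (w : Equiv.Perm ℕ+) : Prop := {x : ℕ+ | w x ≠ x}.Finite

/-- The length `ℓ(w)` of a permutation: its number of inversions, i.e. of pairs
`i < j` with `w i > w j`. -/
noncomputable def len (w : Equiv.Perm ℕ+) : ℕ :=
  Set.ncard {p : ℕ+ × ℕ+ | p.1 < p.2 ∧ w p.2 < w p.1}

/-- Covering relation of the `k`-Bruhat order: `u ⋖_k u(a,b)` for `a ≤ k < b`
with `ℓ(u(a,b)) = ℓ(u) + 1`.  Here `u(a,b) = u * (swap a b)`. -/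
def kBruhatCov (k : ℕ+) (u w : Equiv.Perm ℕ+) : Prop :=
  ∃ a b : ℕ+, a ≤ k ∧ k < b ∧ w = u * Equiv.swap a b ∧ len w = len u + 1

/-- The `k`-Bruhat order `u ≤_k w`: a chain of `k`-Bruhat covers from `u` to `w`
(or `u = w`). -/
def kBruhat (k : ℕ+) : Equiv.Perm ℕ+ → Equiv.Perm ℕ+ → Prop :=
  Relation.ReflTransGen (kBruhatCov k)
/-- The new partial order `⪯` on `S_∞`: `η ⪯ ζ` iff there exist `u ∈ S_∞` and
`k` with `u ≤_k ηu ≤_k ζu`. -/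
def NewOrder (η ζ : Equiv.Perm ℕ+) : Prop :=
  ∃ (u : Equiv.Perm ℕ+) (k : ℕ+), FinSupp u ∧
    kBruhat k u (η * u) ∧ kBruhat k (η * u) (ζ * u)

open Equiv Finset

/-- `u` fixes every positive integer larger than `N`. -/
def FixesAbove (N : ℕ+) (u : Perm ℕ+) : Prop := ∀ i, N < i → u i = i

lemma FixesAbove.finSupp {N : ℕ+} {u : Perm ℕ+} (h : FixesAbove N u) : FinSupp u := by
  refine (Set.finite_Iic N).subset fun i hi => ?_
  by_contra hN
  exact hi (h i (not_le.1 hN))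

lemma FixesAbove.mono {N M : ℕ+} {u : Perm ℕ+} (h : FixesAbove N u) (hNM : N ≤ M) :
    FixesAbove M u := fun i hi => h i (hNM.trans_lt hi)

lemma FinSupp.exists_fixesAbove {u : Perm ℕ+} (h : FinSupp u) : ∃ N, FixesAbove N u := by
  obtain ⟨N, hN⟩ := Set.Finite.bddAbove h
  refine ⟨N, fun i hi => ?_⟩
  by_contra hne
  exact absurd (hN hne) (not_le.2 hi)

lemma FixesAbove.mul {N : ℕ+} {u v : Perm ℕ+} (hu : FixesAbove N u) (hv : FixesAbove N v) :
    FixesAbove N (u * v) := fun i hi => by rw [Perm.mul_apply, hv i hi, hu i hi]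

lemma FixesAbove.inv {N : ℕ+} {u : Perm ℕ+} (hu : FixesAbove N u) : FixesAbove N u.symm :=
  fun i hi => by rw [symm_apply_eq, hu i hi]

lemma FixesAbove.swap {N a b : ℕ+} (ha : a ≤ N) (hb : b ≤ N) :
    FixesAbove N (Equiv.swap a b) := fun _ hi =>
  swap_apply_of_ne_of_ne (ha.trans_lt hi).ne' (hb.trans_lt hi).ne'

lemma FixesAbove.le_iff {N : ℕ+} {u : Perm ℕ+} (hu : FixesAbove N u) (i : ℕ+) :
    u i ≤ N ↔ i ≤ N := by
  constructor
  · intro h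
    by_contra hi
    rw [hu i (not_le.1 hi)] at h
    exact hi h
  · intro h
    by_contra hi
    have := hu (u i) (not_le.1 hi)
    rw [u.injective this] at hi
    exact hi h

lemma FixesAbove.mem_Icc_iff {N : ℕ+} {u : Perm ℕ+} (hu : FixesAbove N u) (i : ℕ+) :
    i ∈ Icc 1 N ↔ u i ∈ Icc 1 N := by
  simp [hu.le_iff]

lemma FinSupp.mul {u v : Perm ℕ+} (hu : FinSupp u) (hv : FinSupp v) : FinSupp (u * v) := by
  obtain ⟨N, hN⟩ := hu.exists_fixesAbove
  obtain ⟨M, hM⟩ := hv.exists_fixesAbove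
  exact ((hN.mono (le_max_left N M)).mul (hM.mono (le_max_right N M))).finSupp

lemma finSupp_swap (a b : ℕ+) : FinSupp (Equiv.swap a b) :=
  (FixesAbove.swap (le_max_left a b) (le_max_right a b)).finSupp

/-- The length as a sum over a finite square containing all inversions. -/
lemma len_eq_sum {N : ℕ+} {u : Perm ℕ+} (hu : FixesAbove N u) :
    (len u : ℤ) = ∑ i ∈ Icc 1 N, ∑ j ∈ Icc 1 N, if i < j ∧ u j < u i then 1 else 0 := by
  have hset : {p : ℕ+ × ℕ+ | p.1 < p.2 ∧ u p.2 < u p.1} =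
      (((Icc 1 N) ×ˢ (Icc 1 N)).filter fun p : ℕ+ × ℕ+ => p.1 < p.2 ∧ u p.2 < u p.1 :
        Finset (ℕ+ × ℕ+)) := by
    ext ⟨i, j⟩
    simp only [Set.mem_ofPred_eq, coe_filter, mem_product, mem_Icc, one_le, true_and]
    refine ⟨fun h => ⟨?_, h⟩, fun h => h.2⟩
    have hj : j ≤ N := by
      by_contra hj
      rw [not_le] at hj
      have h2 := h.2
      rw [hu j hj] at h2
      have : ¬ u i ≤ N := not_le.2 (hj.trans h2)
      rw [hu.le_iff, not_le] at this
      rw [hu i this] at h2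
      exact absurd h.1 (not_lt.2 h2.le)
    exact ⟨h.1.le.trans hj, hj⟩
  rw [len, hset, Set.ncard_coe_finset, card_filter, sum_product]
  push_cast
  rfl

lemma sum_sum_eq_sum_lt (S : Finset ℕ+) (F : ℕ+ → ℕ+ → ℤ) (hF : ∀ a, F a a = 0) :
    ∑ a ∈ S, ∑ b ∈ S, F a b = ∑ a ∈ S, ∑ b ∈ S, if a < b then F a b + F b a else 0 := by
  have h1 : ∑ a ∈ S, ∑ b ∈ S, F a b =
      ∑ a ∈ S, ∑ b ∈ S, (if a < b then F a b else 0) +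
        ∑ a ∈ S, ∑ b ∈ S, (if b < a then F a b else 0) := by
    simp only [← sum_add_distrib]
    refine sum_congr rfl fun a _ => sum_congr rfl fun b _ => ?_
    rcases lt_trichotomy a b with h | rfl | h
    · simp [h, h.not_gt]
    · simp [hF]
    · simp [h, h.not_gt]
  rw [h1, sum_comm (s := S) (t := S) (f := fun a b => if b < a then F a b else 0)]
  simp only [← sum_add_distrib]
  refine sum_congr rfl fun a _ => sum_congr rfl fun b _ => ?_
  split_ifs <;> simp

/-- The change of length under left multiplication by `ζ`, as a signed count of the
inversions of `ζ`. -/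
lemma len_mul_sub {N : ℕ+} {u ζ : Perm ℕ+} (hu : FixesAbove N u) (hζ : FixesAbove N ζ) :
    (len (ζ * u) : ℤ) - len u = ∑ a ∈ Icc 1 N, ∑ b ∈ Icc 1 N,
      if a < b ∧ ζ b < ζ a then (if u.symm a < u.symm b then 1 else -1) else 0 := by
  have key : ∀ ξ : Perm ℕ+, FixesAbove N ξ → (len (ξ * u) : ℤ) =
      ∑ a ∈ Icc 1 N, ∑ b ∈ Icc 1 N, if u.symm a < u.symm b ∧ ξ b < ξ a then 1 else 0 := by
    intro ξ hξ
    rw [len_eq_sum (hξ.mul hu)]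
    refine sum_equiv u hu.mem_Icc_iff fun i _ => sum_equiv u hu.mem_Icc_iff fun j _ =>
      if_congr (by simp) rfl rfl
  have h1 : (len u : ℤ) = ∑ a ∈ Icc 1 N, ∑ b ∈ Icc 1 N,
      if u.symm a < u.symm b ∧ b < a then 1 else 0 := by
    rw [← one_mul u, key 1 fun _ _ => rfl]
    exact sum_congr rfl fun a _ => sum_congr rfl fun b _ => if_congr Iff.rfl rfl rfl
  rw [sum_sum_eq_sum_lt _ _ (by simp)] at h1
  rw [key ζ hζ, sum_sum_eq_sum_lt _ _ (by simp), h1]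
  simp only [← sum_sub_distrib]
  refine sum_congr rfl fun a _ => sum_congr rfl fun b _ => ?_
  by_cases hab : a < b
  · have hne : u.symm a ≠ u.symm b := fun h => hab.ne (u.symm.injective h)
    have hne' : ζ a ≠ ζ b := fun h => hab.ne (ζ.injective h)
    rcases lt_or_gt_of_ne hne with h | h <;> rcases lt_or_gt_of_ne hne' with h' | h' <;>
      simp [hab, h, h', h.not_gt, h'.not_gt, hab.not_gt]
  · simp [hab]

lemma len_swap_mul_sub {N α β : ℕ+} {u : Perm ℕ+} (hu : FixesAbove N u) (hαβ : α < β)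
    (hβ : β ≤ N) :
    (len (Equiv.swap α β * u) : ℤ) - len u = (if u.symm α < u.symm β then 1 else -1) +
      ∑ c ∈ Ioo α β, ((if u.symm α < u.symm c then 1 else -1) +
        (if u.symm c < u.symm β then 1 else -1)) := by
  rw [len_mul_sub hu (FixesAbove.swap (hαβ.le.trans hβ) hβ)]
  set e : ℕ+ → ℕ+ → ℤ := fun a b => if u.symm a < u.symm b then 1 else -1
  change ∑ a ∈ Icc 1 N, ∑ b ∈ Icc 1 N,
    (if a < b ∧ Equiv.swap α β b < Equiv.swap α β a then e a b else 0) =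
      e α β + ∑ c ∈ Ioo α β, (e α c + e c β)
  have hpt : ∀ a b : ℕ+,
      (if a < b ∧ Equiv.swap α β b < Equiv.swap α β a then e a b else 0) =
      (if a = α then (if b = β then e α β else 0) else 0) +
      (if a = α then (if α < b ∧ b < β then e α b else 0) else 0) +
      (if b = β then (if α < a ∧ a < β then e a β else 0) else 0) := by
    intro a b
    rcases eq_or_ne a α with rfl | ha
    · rcases eq_or_ne b β with rfl | hb
      · simp [hαβ]
      · rcases eq_or_ne b a with rfl | hb'
        · simp [hb]
        · simp [hb, swap_apply_of_ne_of_ne hb' hb]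
    · rcases eq_or_ne a β with rfl | ha'
      · rcases eq_or_ne b a with rfl | hb
        · simp [ha]
        · by_cases hab : a < b
          · have hb' : b ≠ α := (hαβ.trans hab).ne'
            simp [ha, hb, swap_apply_of_ne_of_ne hb' hb, (hαβ.trans hab).le, not_lt.2]
          · simp [ha, hb, hab]
      · rw [swap_apply_of_ne_of_ne ha ha']
        rcases eq_or_ne b β with rfl | hb
        · simp [ha, and_comm]
        · rcases eq_or_ne b α with rfl | hb'
          · have : ¬ (a < b ∧ β < a) := fun h => absurd (h.1.trans hαβ) h.2.not_gt
            simp [ha, hb, this]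
          · rw [swap_apply_of_ne_of_ne hb' hb]
            have : ¬ (a < b ∧ b < a) := fun h => h.1.not_gt h.2
            simp [ha, hb, this]
  have hα1 : α ∈ Icc 1 N := by simp [hαβ.le.trans hβ]
  have hβ1 : β ∈ Icc 1 N := by simp [hβ]
  have hfil : (Icc 1 N).filter (fun c => α < c ∧ c < β) = Ioo α β := by
    ext c
    simp only [mem_filter, mem_Icc, one_le, true_and, mem_Ioo]
    exact ⟨fun h => h.2, fun h => ⟨h.2.le.trans hβ, h⟩⟩
  simp only [hpt, sum_add_distrib]
  rw [sum_comm (f := fun a b => if b = β then (if α < a ∧ a < β then e a β else 0) else 0)]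
  have h3 : ∀ f : ℕ+ → ℤ, ∑ a ∈ Icc 1 N, ∑ b ∈ Icc 1 N, (if a = α then f b else 0) =
      ∑ b ∈ Icc 1 N, f b := by
    intro f
    rw [sum_comm]
    simp [hα1]
  have h4 : ∀ f : ℕ+ → ℤ, ∑ a ∈ Icc 1 N, ∑ b ∈ Icc 1 N, (if a = β then f b else 0) =
      ∑ b ∈ Icc 1 N, f b := by
    intro f
    rw [sum_comm]
    simp [hβ1]
  rw [h3, h3, h4, ← hfil, sum_filter, sum_filter, sum_ite_eq', if_pos hβ1, add_assoc]

lemma kBruhatCov_iff {k : ℕ+} {u w : Perm ℕ+} (hu : FinSupp u) :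
    kBruhatCov k u w ↔ ∃ a b : ℕ+, a ≤ k ∧ k < b ∧ w = u * Equiv.swap a b ∧ u a < u b ∧
      ∀ c, a < c → c < b → u a < u c → u c < u b → False := by
  unfold kBruhatCov
  refine exists_congr fun a => exists_congr fun b => and_congr_right fun ha =>
    and_congr_right fun hb => and_congr_right fun hw => ?_
  have hab : a < b := ha.trans_lt hb
  obtain ⟨N₀, hN₀⟩ := hu.exists_fixesAbove
  set N := max N₀ (max (u a) (u b))
  have hN : FixesAbove N u := hN₀.mono (le_max_left _ _)
  have hua : u a ≤ N := (le_max_left _ _).trans (le_max_right _ _)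
  have hub : u b ≤ N := (le_max_right _ _).trans (le_max_right _ _)
  rw [hw, mul_swap_eq_swap_mul]
  have hcast : ∀ v : Perm ℕ+, len v = len u + 1 ↔ (len v : ℤ) - len u = 1 := fun v => by omega
  rw [hcast]
  rcases lt_trichotomy (u a) (u b) with h | h | h
  · rw [len_swap_mul_sub hN h hub]
    simp only [symm_apply_apply, hab, if_true, h, true_and]
    have hnn : ∀ c ∈ Ioo (u a) (u b), (0 : ℤ) ≤ (if a < u.symm c then 1 else -1) +
        (if u.symm c < b then 1 else -1) := by
      intro c _
      by_cases h1 : a < u.symm c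
      · split_ifs <;> simp
      · simp [h1, (not_lt.1 h1).trans_lt hab]
    rw [add_eq_left, sum_eq_zero_iff_of_nonneg hnn]
    constructor
    · intro H c h1 h2 h3 h4
      have := H (u c) (mem_Ioo.2 ⟨h3, h4⟩)
      simp [h1, h2] at this
    · intro H c hc
      rw [mem_Ioo] at hc
      have hca : u.symm c ≠ a := fun h => by
        rw [symm_apply_eq] at h; exact hc.1.ne' h
      have hcb : u.symm c ≠ b := fun h => by
        rw [symm_apply_eq] at h; exact hc.2.ne h
      by_cases h1 : a < u.symm c
      · have h2 : ¬ u.symm c < b := fun h2 => H _ h1 h2 (by simpa using hc.1) (by simpa using hc.2)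
        simp [h1, h2]
      · simp [h1, (not_lt.1 h1).trans_lt hab]
  · exact absurd (u.injective h) hab.ne
  · rw [swap_comm, len_swap_mul_sub hN h hua]
    simp only [symm_apply_apply, hab.not_gt, if_false, h.not_gt, false_and, iff_false]
    have hnp : ∑ c ∈ Ioo (u b) (u a), ((if b < u.symm c then (1 : ℤ) else -1) +
        (if u.symm c < a then 1 else -1)) ≤ 0 := by
      refine sum_nonpos fun c _ => ?_
      by_cases h1 : b < u.symm c
      · simp [h1, (hab.trans h1).not_gt]
      · split_ifs <;> simp
    omega

lemma kBruhatCov.finSupp {k : ℕ+} {u w : Perm ℕ+} (h : kBruhatCov k u w) (hu : FinSupp u) :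
    FinSupp w := by
  obtain ⟨a, b, -, -, rfl, -⟩ := h
  exact hu.mul (finSupp_swap a b)

/-- An induction principle for `k`-Bruhat chains starting at an element of `S_∞`. -/
lemma kBruhat.rec_cover {k : ℕ+} {w : Perm ℕ+} {C : Perm ℕ+ → Prop} (refl : C w)
    (step : ∀ y z, FinSupp y → kBruhatCov k y z → kBruhat k z w → C z → C y)
    {u : Perm ℕ+} (h : kBruhat k u w) (hu : FinSupp u) : C u := by
  induction h using Relation.ReflTransGen.head_induction_on with
  | refl => exact refl
  | head hc hr ih => exact step _ _ hu hc hr (ih (hc.finSupp hu))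

lemma kBruhatCov.le_of_le {k : ℕ+} {u w : Perm ℕ+} (h : kBruhatCov k u w) (hu : FinSupp u)
    {i : ℕ+} (hi : i ≤ k) : u i ≤ w i := by
  obtain ⟨a, b, ha, hb, rfl, hlt, -⟩ := (kBruhatCov_iff hu).1 h
  have hib : i ≠ b := (hi.trans_lt hb).ne
  rcases eq_or_ne i a with rfl | hia
  · simpa using hlt.le
  · simp [swap_apply_of_ne_of_ne hia hib]

lemma kBruhatCov.ge_of_lt {k : ℕ+} {u w : Perm ℕ+} (h : kBruhatCov k u w) (hu : FinSupp u)
    {i : ℕ+} (hi : k < i) : w i ≤ u i := by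
  obtain ⟨a, b, ha, hb, rfl, hlt, -⟩ := (kBruhatCov_iff hu).1 h
  have hia : i ≠ a := (ha.trans_lt hi).ne'
  rcases eq_or_ne i b with rfl | hib
  · simpa using hlt.le
  · simp [swap_apply_of_ne_of_ne hia hib]

lemma kBruhat.le_of_le {k : ℕ+} {u w : Perm ℕ+} (h : kBruhat k u w) (hu : FinSupp u)
    {i : ℕ+} (hi : i ≤ k) : u i ≤ w i :=
  kBruhat.rec_cover (C := fun u => u i ≤ w i) le_rfl
    (fun _ _ hy hc _ ih => (hc.le_of_le hy hi).trans ih) h hu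

lemma kBruhat.ge_of_lt {k : ℕ+} {u w : Perm ℕ+} (h : kBruhat k u w) (hu : FinSupp u)
    {i : ℕ+} (hi : k < i) : w i ≤ u i :=
  kBruhat.rec_cover (C := fun u => w i ≤ u i) le_rfl
    (fun _ _ hy hc _ ih => ih.trans (hc.ge_of_lt hy hi)) h hu

lemma kBruhatCov.apply_lt {k : ℕ+} {u w : Perm ℕ+} (h : kBruhatCov k u w) (hu : FinSupp u)
    {i j : ℕ+} (hij : i < j) (hside : j ≤ k ∨ k < i) (hlt : u i < u j) : w i < w j := by
  obtain ⟨a, b, ha, hb, rfl, hab, hc⟩ := (kBruhatCov_iff hu).1 h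
  rcases hside with hj | hi
  · have hib : i ≠ b := ((hij.le.trans hj).trans_lt hb).ne
    have hjb : j ≠ b := (hj.trans_lt hb).ne
    rcases eq_or_ne i a with rfl | hia
    · simp only [Perm.mul_apply, swap_apply_left, swap_apply_of_ne_of_ne hij.ne' hjb]
      refine lt_of_le_of_ne (not_lt.1 fun h => hc j hij (hj.trans_lt hb) hlt h) fun h => ?_
      exact hjb (u.injective h).symm
    · rcases eq_or_ne j a with rfl | hja
      · simpa [swap_apply_of_ne_of_ne hia hib] using hlt.trans hab
      · simpa [swap_apply_of_ne_of_ne hia hib, swap_apply_of_ne_of_ne hja hjb] using hlt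
  · have hia : i ≠ a := (ha.trans_lt hi).ne'
    have hja : j ≠ a := (ha.trans_lt (hi.trans hij)).ne'
    rcases eq_or_ne j b with rfl | hjb
    · simp only [Perm.mul_apply, swap_apply_right, swap_apply_of_ne_of_ne hia hij.ne]
      refine lt_of_le_of_ne (not_lt.1 fun h => hc i (ha.trans_lt hi) hij h hlt) fun h => ?_
      exact hia (u.injective h)
    · rcases eq_or_ne i b with rfl | hib
      · simpa [swap_apply_of_ne_of_ne hja hjb] using hab.trans hlt
      · simpa [swap_apply_of_ne_of_ne hia hib, swap_apply_of_ne_of_ne hja hjb] using hlt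

lemma kBruhat.apply_lt {k : ℕ+} {u w : Perm ℕ+} (h : kBruhat k u w) (hu : FinSupp u)
    {i j : ℕ+} (hij : i < j) (hside : j ≤ k ∨ k < i) (hlt : u i < u j) : w i < w j :=
  kBruhat.rec_cover (C := fun u => u i < u j → w i < w j) id
    (fun _ _ hy hc _ ih h => ih (hc.apply_lt hy hij hside h)) h hu hlt

/-- The direction in which `ζ` moves a point. -/
def moveSign (ζ : Perm ℕ+) (a : ℕ+) : ℤ := if a < ζ a then 1 else if ζ a < a then -1 else 0

/-- As many points move upwards over a fixed point as move downwards over it. -/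
lemma sum_crossing_fixed {N c : ℕ+} {ζ : Perm ℕ+} (hζ : FixesAbove N ζ) (hc : ζ c = c) :
    ∑ a ∈ Icc 1 N, ((if a < c ∧ c < ζ a then (1 : ℤ) else 0) -
      (if c < a ∧ ζ a < c then 1 else 0)) = 0 := by
  have h1 : ∑ a ∈ Icc 1 N, (if ζ a < c then (1 : ℤ) else 0) =
      ∑ a ∈ Icc 1 N, (if a < c then (1 : ℤ) else 0) :=
    sum_equiv ζ hζ.mem_Icc_iff fun _ _ => rfl
  refine Eq.trans ?_ (sub_eq_zero.2 h1.symm)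
  rw [← sum_sub_distrib]
  refine sum_congr rfl fun a _ => ?_
  rcases lt_trichotomy a c with h | h | h <;> rcases lt_trichotomy (ζ a) c with h' | h' | h'
  all_goals first
    | simp [h, h', h.not_gt, h'.not_gt]; done
    | (exfalso
       first
        | (rw [h, hc] at h'; exact lt_irrefl _ h')
        | (have := ζ.injective (h'.trans hc.symm)
           rw [this] at h; exact lt_irrefl _ h))
    | (rw [h, hc]; simp)

/-- The rank of `ζ` can be computed from `ζ` alone. -/
lemma len_sub_eq_of_kBruhat {N k : ℕ+} {u ζ : Perm ℕ+} (hu : FixesAbove N u)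
    (hζ : FixesAbove N ζ) (h : kBruhat k u (ζ * u)) :
    (len (ζ * u) : ℤ) - len u = -∑ a ∈ Icc 1 N, ∑ b ∈ Icc 1 N,
      if a < b ∧ ζ b < ζ a then moveSign ζ a * moveSign ζ b else 0 := by
  set s : ℕ+ → ℤ := fun a => if u.symm a ≤ k then 1 else -1 with hs
  have hup : ∀ a, u.symm a ≤ k → a ≤ ζ a := fun a ha => by
    simpa using h.le_of_le hu.finSupp ha
  have hdown : ∀ a, k < u.symm a → ζ a ≤ a := fun a ha => by
    simpa using h.ge_of_lt hu.finSupp ha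
  have hside : ∀ a b, a < b → ζ b < ζ a → (u.symm b ≤ k ∨ k < u.symm a) → ¬ u.symm a < u.symm b := by
    intro a b hab hζab hk hlt
    have := h.apply_lt hu.finSupp hlt hk (by simpa using hab)
    simp only [Perm.mul_apply, apply_symm_apply] at this
    exact hζab.not_gt this
  set f : ℕ+ → ℤ := fun a => if ζ a = a then s a else 0 with hf
  have hst : ∀ a, s a = moveSign ζ a + f a := by
    intro a
    simp only [hs, hf, moveSign]
    by_cases ha : u.symm a ≤ k
    · rcases (hup a ha).eq_or_lt with h' | h'
      · simp [ha, ← h']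
      · simp [ha, h', h'.ne']
    · rcases (hdown a (not_le.1 ha)).eq_or_lt with h' | h'
      · simp [ha, h']
      · simp [ha, h', h'.ne, h'.not_gt]
  rw [len_mul_sub hu hζ]
  have e1 : ∀ a b, (if a < b ∧ ζ b < ζ a then (if u.symm a < u.symm b then (1 : ℤ) else -1) else 0) =
      -(if a < b ∧ ζ b < ζ a then moveSign ζ a * moveSign ζ b else 0) -
      (f b * ((if a < b ∧ b < ζ a then (1 : ℤ) else 0) - (if b < a ∧ ζ a < b then 1 else 0)) +
       (f b * (if b < a ∧ ζ a < b then 1 else 0) -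
         f a * (if a < b ∧ ζ b < a then 1 else 0))) := by
    intro a b
    have eb : f b * (if a < b ∧ b < ζ a then (1 : ℤ) else 0) =
        if a < b ∧ ζ b < ζ a then moveSign ζ a * f b else 0 := by
      by_cases hb : ζ b = b
      · rw [hb]
        split_ifs with h'
        · simp [moveSign, h'.1.trans h'.2]
        · simp
      · simp [hf, hb]
    have ea : f a * (if a < b ∧ ζ b < a then (1 : ℤ) else 0) =
        if a < b ∧ ζ b < ζ a then -(f a * moveSign ζ b) else 0 := by
      by_cases ha : ζ a = a
      · rw [ha]
        split_ifs with h'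
        · simp [moveSign, h'.2.trans h'.1, (h'.2.trans h'.1).not_gt]
        · simp
      · simp [hf, ha]
    have eab : a < b ∧ ζ b < ζ a → f a * f b = 0 := by
      intro h'
      by_cases ha : ζ a = a
      · have hb : ζ b ≠ b := fun hb => by
          rw [ha, hb] at h'; exact h'.1.not_gt h'.2
        simp [hf, hb]
      · simp [hf, ha]
    have hsum : (if a < b ∧ ζ b < ζ a then (if u.symm a < u.symm b then (1 : ℤ) else -1) else 0) =
        -(if a < b ∧ ζ b < ζ a then s a * s b else 0) := by
      split_ifs with hinv hpos
      · have h1 := fun hk => hside a b hinv.1 hinv.2 hk hpos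
        have : u.symm a ≤ k ∧ k < u.symm b := by
          constructor
          · by_contra hk; exact h1 (Or.inr (not_le.1 hk))
          · by_contra hk; exact h1 (Or.inl (not_lt.1 hk))
        simp [hs, this.1, this.2.not_ge]
      · have hba : u.symm b < u.symm a := lt_of_le_of_ne (not_lt.1 hpos)
          fun h' => hinv.1.ne' (u.symm.injective h')
        by_cases ha : u.symm a ≤ k
        · simp [hs, ha, hba.le.trans ha]
        · by_cases hb : u.symm b ≤ k
          · have h1 := hup b hb
            have h2 := hdown a (not_le.1 ha)
            exact absurd (hinv.1.trans_le h1) (hinv.2.trans_le h2).not_gt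
          · simp [hs, ha, hb]
      · simp
    rw [hsum, mul_sub, eb, ea, hst a, hst b]
    by_cases hinv : a < b ∧ ζ b < ζ a
    · simp only [if_pos hinv]
      linear_combination -(eab hinv)
    · simp only [if_neg hinv]
      ring
  simp only [e1, sum_sub_distrib, sum_add_distrib, sum_neg_distrib]
  have z1 : ∑ a ∈ Icc 1 N, ∑ b ∈ Icc 1 N, f b * ((if a < b ∧ b < ζ a then (1 : ℤ) else 0) -
      (if b < a ∧ ζ a < b then 1 else 0)) = 0 := by
    rw [sum_comm]
    refine sum_eq_zero fun b _ => ?_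
    rw [← mul_sum]
    by_cases hb : ζ b = b
    · rw [sum_crossing_fixed hζ hb, mul_zero]
    · simp [hf, hb]
  rw [z1, sum_comm (f := fun a b => f b * (if b < a ∧ ζ a < b then (1 : ℤ) else 0))]
  ring

lemma len_sub_eq_len_sub {k l : ℕ+} {u x ζ : Perm ℕ+} (hζ : FinSupp ζ) (hu : FinSupp u)
    (hx : FinSupp x) (h : kBruhat k u (ζ * u)) (h' : kBruhat l x (ζ * x)) :
    (len (ζ * u) : ℤ) - len u = len (ζ * x) - len x := by
  obtain ⟨A, hA⟩ := hζ.exists_fixesAbove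
  obtain ⟨B, hB⟩ := hu.exists_fixesAbove
  obtain ⟨C, hC⟩ := hx.exists_fixesAbove
  have hA' := hA.mono (le_max_left A (max B C))
  rw [len_sub_eq_of_kBruhat
      (hB.mono ((le_max_left B C).trans (le_max_right A _))) hA' h,
    len_sub_eq_of_kBruhat (hC.mono ((le_max_right B C).trans (le_max_right A _))) hA' h']

lemma exists_finSupp_eq_of_le {p : ℕ+ → ℕ+} (hp : p.Injective) (n : ℕ+) :
    ∃ π : Perm ℕ+, FinSupp π ∧ ∀ i ≤ n, π i = p i := by
  induction n using PNat.recOn with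
  | one =>
    refine ⟨Equiv.swap 1 (p 1), finSupp_swap _ _, fun i hi => ?_⟩
    rw [le_antisymm hi one_le, swap_apply_left]
  | succ n ih =>
    obtain ⟨π, hπ, h⟩ := ih
    refine ⟨Equiv.swap (π (n + 1)) (p (n + 1)) * π, (finSupp_swap _ _).mul hπ, fun i hi => ?_⟩
    rcases hi.eq_or_lt with rfl | hlt
    · simp
    · have hin : i ≤ n := PNat.lt_add_one_iff.1 hlt
      rw [Perm.mul_apply, swap_apply_of_ne_of_ne (fun h' => hlt.ne (π.injective h')), h i hin]
      rw [h i hin]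
      exact fun h' => hlt.ne (hp h')

lemma exists_sorting (M : ℕ) (f : ℕ+ → ℕ+) (hf : f.Injective) :
    ∃ u : Perm ℕ+, (∀ i : ℕ+, M < i → u i = i) ∧
      ∀ i j : ℕ+, i < j → (j : ℕ) ≤ M → f (u i) < f (u j) := by
  induction M generalizing f with
  | zero => exact ⟨1, fun _ _ => rfl, fun i j _ hj => absurd hj (not_le.2 j.pos)⟩
  | succ M ih =>
    set m₁ : ℕ+ := M.succPNat with hm₁
    have hm₁' : (m₁ : ℕ) = M + 1 := rfl
    obtain ⟨m, hm, hmax⟩ := (Icc 1 m₁).exists_max_image f ⟨1, by simp⟩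
    have hmle : (m : ℕ) ≤ M + 1 := by
      have := (mem_Icc.1 hm).2
      rw [← PNat.coe_le_coe] at this
      omega
    obtain ⟨u, hu, hmono⟩ := ih (f ∘ Equiv.swap m m₁) (hf.comp (Equiv.injective _))
    refine ⟨Equiv.swap m m₁ * u, fun i hi => ?_, fun i j hij hj => ?_⟩
    · rw [Perm.mul_apply, hu i (by omega), swap_apply_of_ne_of_ne]
      · rintro rfl; omega
      · rintro rfl; omega
    · rcases Nat.lt_or_ge M j with hlt | hle
      · have hj₁ : j = m₁ := PNat.eq (by omega)
        subst hj₁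
        rw [Perm.mul_apply, Perm.mul_apply, hu _ hlt, swap_apply_right]
        have hui : u i ≠ m₁ := fun h => hij.ne (u.injective (h.trans (hu _ hlt).symm))
        have huile : (u i : ℕ) ≤ M := by
          by_contra hc
          have := u.injective (hu (u i) (not_le.1 hc))
          rw [this] at hc
          rw [← PNat.coe_lt_coe] at hij
          omega
        refine lt_of_le_of_ne (hmax _ ?_) fun h => ?_
        · rw [mem_Icc]
          refine ⟨one_le, ?_⟩
          rcases eq_or_ne (u i) m with h | h
          · simp [h]
          · rw [swap_apply_of_ne_of_ne h hui, ← PNat.coe_le_coe]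
            omega
        · have h1 := hf h
          rw [swap_apply_eq_iff, swap_apply_left] at h1
          exact hui h1
      · exact hmono i j hij hle

/-- The positions of the values in `range p` can be enumerated increasingly, and the
resulting pattern is a finitely supported permutation. -/
lemma exists_pattern {p : ℕ+ → ℕ+} (hp : StrictMono p) {x : Perm ℕ+} (hx : FinSupp x) :
    ∃ (q : ℕ+ → ℕ+) (u : Perm ℕ+), StrictMono q ∧ FinSupp u ∧
      (∀ i, x (q i) = p (u i)) ∧ ∀ b, x b ∈ Set.range p → b ∈ Set.range q := by
  obtain ⟨M, hM⟩ := hx.exists_fixesAbove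
  set f : ℕ+ → ℕ+ := fun i => x.symm (p i) with hf
  have hple : ∀ i, i ≤ p i := fun _ => hp.le_apply
  have hfabove : ∀ i, M < p i → f i = p i := fun i hi => hM.inv _ hi
  obtain ⟨u, hu, hmono⟩ := exists_sorting M f (x.symm.injective.comp hp.injective)
  have huM : FixesAbove M u := fun i hi => hu i (PNat.coe_lt_coe _ _ |>.2 hi)
  refine ⟨fun i => f (u i), u, fun i j hij => ?_, huM.finSupp, fun i => by simp [hf], ?_⟩
  · rcases le_or_gt j M with hj | hj
    · exact hmono i j hij (PNat.coe_le_coe _ _ |>.2 hj)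
    · show f (u i) < f (u j)
      have hfj : f (u j) = p j := by rw [huM j hj]; exact hfabove j (hj.trans_le (hple j))
      rw [hfj]
      rcases le_or_gt (p (u i)) M with hi | hi
      · exact ((hM.inv.le_iff _).2 hi).trans_lt (hj.trans_le (hple j))
      · rw [hfabove _ hi]
        refine hp ?_
        rcases le_or_gt i M with hiM | hiM
        · exact ((huM.le_iff i).2 hiM).trans_lt hj
        · rwa [huM i hiM]
  · rintro b ⟨c, hc⟩
    exact ⟨u.symm c, by simp [hf, hc]⟩

lemma exists_cut {q : ℕ+ → ℕ+} (hq : StrictMono q) (l : ℕ+) :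
    ∃ k : ℕ+, ∀ i j, q i ≤ l → l < q j → i ≤ k ∧ k < j := by
  by_cases h : q 1 ≤ l
  · obtain ⟨k, hk, hmax⟩ := ((Icc 1 l).filter fun m => q m ≤ l).exists_max_image id
      ⟨1, by simp [h]⟩
    refine ⟨k, fun i j hi hj => ⟨hmax i ?_, ?_⟩⟩
    · simpa [hi] using (hq.le_apply (x := i)).trans hi
    · exact hq.lt_iff_lt.1 ((mem_filter.1 hk).2.trans_lt hj)
  · exact ⟨1, fun i _ hi _ => absurd ((hq.monotone one_le).trans hi) h⟩

/-- A chain moving only values at positions in `range q` restricts to a chain of patterns. -/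
lemma kBruhat.pattern {p q : ℕ+ → ℕ+} (hp : StrictMono p) (hq : StrictMono q) {k l : ℕ+}
    (hk : ∀ i j, q i ≤ l → l < q j → i ≤ k ∧ k < j) {y w : Perm ℕ+} (h : kBruhat l y w)
    (hy : FinSupp y) (hoff : ∀ b, b ∉ Set.range q → w b = y b) {u v : Perm ℕ+}
    (hu : FinSupp u) (hyu : ∀ i, y (q i) = p (u i)) (hwv : ∀ i, w (q i) = p (v i)) :
    kBruhat k u v := by
  refine kBruhat.rec_cover (C := fun y => (∀ b, b ∉ Set.range q → w b = y b) →
    ∀ u, FinSupp u → (∀ i, y (q i) = p (u i)) → kBruhat k u v) ?_ ?_ h hy hoff u hu hyu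
  · intro _ u _ hu
    have : u = v := Equiv.ext fun i => hp.injective ((hu i).symm.trans (hwv i))
    rw [this]
    exact Relation.ReflTransGen.refl
  · intro y z hy hc hzw ih hoff u hu hyu
    have hz : FinSupp z := hc.finSupp hy
    have hzoff : ∀ b, b ∉ Set.range q → z b = y b := by
      intro b hb
      rcases le_or_gt b l with hbl | hbl
      · exact le_antisymm ((hzw.le_of_le hz hbl).trans (hoff b hb).le) (hc.le_of_le hy hbl)
      · exact le_antisymm (hc.ge_of_lt hy hbl) ((hoff b hb).ge.trans (hzw.ge_of_lt hz hbl))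
    obtain ⟨a, b, ha, hb, rfl, hlt, hbt⟩ := (kBruhatCov_iff hy).1 hc
    have haq : a ∈ Set.range q := by
      by_contra hn
      have := hzoff a hn
      simp only [Perm.mul_apply, swap_apply_left] at this
      exact hlt.ne' this
    have hbq : b ∈ Set.range q := by
      by_contra hn
      have := hzoff b hn
      simp only [Perm.mul_apply, swap_apply_right] at this
      exact hlt.ne this
    obtain ⟨i, rfl⟩ := haq
    obtain ⟨j, rfl⟩ := hbq
    obtain ⟨hik, hkj⟩ := hk i j ha hb
    have hcov : kBruhatCov k u (u * Equiv.swap i j) := by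
      refine (kBruhatCov_iff hu).2 ⟨i, j, hik, hkj, rfl, ?_, fun c h1 h2 h3 h4 => ?_⟩
      · rwa [hyu, hyu, hp.lt_iff_lt] at hlt
      · refine hbt (q c) (hq h1) (hq h2) ?_ ?_
        · rw [hyu, hyu]; exact hp h3
        · rw [hyu, hyu]; exact hp h4
    refine Relation.ReflTransGen.head hcov (ih (fun b hb => ?_) _ (hcov.finSupp hu) fun m => ?_)
    · rw [hoff b hb, hzoff b hb]
    · rw [Perm.mul_apply, Perm.mul_apply, ← hq.injective.map_swap, hyu]

/-- A chain starting at `u` is carried by `Φ`, followed by a suitable rearrangement of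
positions, to a chain with the same change of length. -/
lemma kBruhat.exists_map {p : ℕ+ → ℕ+} (hp : StrictMono p) {Φ : Perm ℕ+ → Perm ℕ+}
    (hfin : ∀ ζ, FinSupp ζ → FinSupp (Φ ζ)) (hmul : ∀ ξ ζ, Φ (ξ * ζ) = Φ ξ * Φ ζ)
    (hmap : ∀ ζ i, Φ ζ (p i) = p (ζ i))
    (hswap : ∀ a b, Φ (Equiv.swap a b) = Equiv.swap (p a) (p b))
    {k : ℕ+} {u w : Perm ℕ+} (h : kBruhat k u w) (hu : FinSupp u) :
    ∃ N : ℕ+, ∀ π : Perm ℕ+, FinSupp π → (∀ i ≤ N, π i = p i) →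
      kBruhat k (Φ u * π) (Φ w * π) ∧
      (len (Φ w * π) : ℤ) - len (Φ u * π) = len w - len u := by
  refine kBruhat.rec_cover (C := fun u => ∃ N : ℕ+, ∀ π : Perm ℕ+, FinSupp π →
    (∀ i ≤ N, π i = p i) → kBruhat k (Φ u * π) (Φ w * π) ∧
      (len (Φ w * π) : ℤ) - len (Φ u * π) = len w - len u) ?_ ?_ h hu
  · exact ⟨1, fun π _ _ => ⟨Relation.ReflTransGen.refl, by simp⟩⟩
  · rintro y z hy hc - ⟨N, hN⟩
    obtain ⟨a, b, ha, hb, rfl, hlt, hbt⟩ := (kBruhatCov_iff hy).1 hc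
    refine ⟨max N b, fun π hπ hπp => ?_⟩
    obtain ⟨h1, h2⟩ := hN π hπ fun i hi => hπp i (hi.trans (le_max_left _ _))
    have hπb : ∀ i ≤ b, π i = p i := fun i hi => hπp i (hi.trans (le_max_right _ _))
    have hab : a < b := ha.trans_lt hb
    have hval : ∀ i ≤ b, (Φ y * π) i = p (y i) := fun i hi => by
      rw [Perm.mul_apply, hπb i hi, hmap]
    have hcov : kBruhatCov k (Φ y * π) (Φ (y * Equiv.swap a b) * π) := by
      refine (kBruhatCov_iff ((hfin y hy).mul hπ)).2 ⟨a, b, ha, hb, ?_, ?_, ?_⟩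
      · rw [hmul, hswap, mul_assoc, mul_assoc, mul_swap_eq_swap_mul, hπb a hab.le, hπb b le_rfl]
      · rw [hval a hab.le, hval b le_rfl]
        exact hp hlt
      · intro c hac hcb
        rw [hval a hab.le, hval b le_rfl, hval c hcb.le, hp.lt_iff_lt, hp.lt_iff_lt]
        exact hbt c hac hcb
    refine ⟨Relation.ReflTransGen.head hcov h1, ?_⟩
    obtain ⟨_, _, _, _, _, e1⟩ := hcov
    obtain ⟨_, _, _, _, _, e2⟩ := hc
    omega

/-- Let `P = {p 1 < p 2 < ⋯}` be an infinite subset of the positive integers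
(given by its strictly increasing enumeration `p`) and let `Φ = φ_P` be the
homomorphism with `Φ ζ` fixing everything outside `P` and `Φ ζ (p i) = p (ζ i)`.
Then `φ_P` is an injection of graded posets for `⪯`: `η ⪯ ζ ↔ φ_P(η) ⪯ φ_P(ζ)`,
and `|φ_P(ζ)| = |ζ|`, where `|ξ| = ℓ(ξu) - ℓ(u)` for any `u ∈ S_∞`, `k` with
`u ≤_k ξu`. -/
theorem stmt_13 (p : ℕ+ → ℕ+) (hp : StrictMono p)
    (Φ : Equiv.Perm ℕ+ → Equiv.Perm ℕ+)
    (hΦfix : ∀ (ζ : Equiv.Perm ℕ+) (x : ℕ+), x ∉ Set.range p → Φ ζ x = x)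
    (hΦmap : ∀ (ζ : Equiv.Perm ℕ+) (i : ℕ+), Φ ζ (p i) = p (ζ i))
    (η ζ : Equiv.Perm ℕ+) (hη : FinSupp η) (hζ : FinSupp ζ) :
    (NewOrder η ζ ↔ NewOrder (Φ η) (Φ ζ)) ∧
    (∀ (u : Equiv.Perm ℕ+) (k : ℕ+), FinSupp u → kBruhat k u (ζ * u) →
      ∀ (x : Equiv.Perm ℕ+) (l : ℕ+), FinSupp x → kBruhat l x (Φ ζ * x) →
        (len (ζ * u) : ℤ) - (len u : ℤ) = (len (Φ ζ * x) : ℤ) - (len x : ℤ)) := by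
  have hmul : ∀ ξ ζ, Φ (ξ * ζ) = Φ ξ * Φ ζ := by
    intro ξ ζ
    ext x : 1
    by_cases hx : x ∈ Set.range p
    · obtain ⟨i, rfl⟩ := hx
      simp [hΦmap]
    · simp [hΦfix _ _ hx]
  have hfin : ∀ ζ, FinSupp ζ → FinSupp (Φ ζ) := by
    intro ζ hζ
    refine (Set.Finite.image p hζ).subset fun x hx => ?_
    by_cases hxp : x ∈ Set.range p
    · obtain ⟨i, rfl⟩ := hxp
      exact ⟨i, fun h => hx (by rw [hΦmap, h]), rfl⟩
    · exact absurd (hΦfix ζ x hxp) hx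
  have hswap : ∀ a b, Φ (Equiv.swap a b) = Equiv.swap (p a) (p b) := by
    intro a b
    ext x : 1
    by_cases hx : x ∈ Set.range p
    · obtain ⟨i, rfl⟩ := hx
      rw [hΦmap, hp.injective.map_swap]
    · rw [hΦfix _ _ hx, swap_apply_of_ne_of_ne]
      · rintro rfl; exact hx ⟨a, rfl⟩
      · rintro rfl; exact hx ⟨b, rfl⟩
  refine ⟨⟨?_, ?_⟩, ?_⟩
  · rintro ⟨u, k, hu, h1, h2⟩
    obtain ⟨N₁, hN₁⟩ := h1.exists_map hp hfin hmul hΦmap hswap hu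
    obtain ⟨N₂, hN₂⟩ := h2.exists_map hp hfin hmul hΦmap hswap (hη.mul hu)
    obtain ⟨π, hπ, hπp⟩ := exists_finSupp_eq_of_le hp.injective (max N₁ N₂)
    refine ⟨Φ u * π, k, (hfin u hu).mul hπ, ?_, ?_⟩
    · rw [← mul_assoc, ← hmul]
      exact (hN₁ π hπ fun i hi => hπp i (hi.trans (le_max_left _ _))).1
    · rw [← mul_assoc, ← mul_assoc, ← hmul, ← hmul]
      exact (hN₂ π hπ fun i hi => hπp i (hi.trans (le_max_right _ _))).1
  · rintro ⟨x, l, hx, h1, h2⟩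
    obtain ⟨q, u, hq, hu, hxq, hrange⟩ := exists_pattern hp hx
    obtain ⟨k, hk⟩ := exists_cut hq l
    have hoff : ∀ ξ : Equiv.Perm ℕ+, ∀ b, b ∉ Set.range q → (Φ ξ * x) b = x b :=
      fun ξ b hb => hΦfix ξ (x b) fun h => hb (hrange b h)
    have hpat : ∀ ξ : Equiv.Perm ℕ+, ∀ i, (Φ ξ * x) (q i) = p ((ξ * u) i) := fun ξ i => by
      rw [Perm.mul_apply, hxq, hΦmap, Perm.mul_apply]
    exact ⟨u, k, hu, h1.pattern hp hq hk hx (hoff η) hu hxq (hpat η),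
      h2.pattern hp hq hk ((hfin η hη).mul hx)
        (fun b hb => (hoff ζ b hb).trans (hoff η b hb).symm) (hη.mul hu) (hpat η) (hpat ζ)⟩
  · intro u k hu h x l hx hx'
    obtain ⟨N, hN⟩ := h.exists_map hp hfin hmul hΦmap hswap hu
    obtain ⟨π, hπ, hπp⟩ := exists_finSupp_eq_of_le hp.injective N
    obtain ⟨h1, h2⟩ := hN π hπ hπp
    rw [hmul, mul_assoc] at h1 h2
    rw [← h2]
    exact len_sub_eq_len_sub (hfin ζ hζ) ((hfin u hu).mul hπ) hx h1 hx'
end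

section
/- Fix n ≥ 1 and let w₀ ∈ S_∞ be the permutation with w₀(i) = n + 1 − i for i ≤ n and w₀(i) = i for i > n. For permutations η, ζ ∈ S_∞ fixing every i > n, one has η ⪯ ζ if and only if w₀ηw₀ ⪯ w₀ζw₀; that is, conjugation by w₀ is an automorphism of (S_n, ⪯). -/
/-- The inversions of `w`; `len w` is the cardinality of this set. -/
def inversions (w : Equiv.Perm ℕ+) : Set (ℕ+ × ℕ+) :=
  {p | p.1 < p.2 ∧ w p.2 < w p.1}

theorem FinSupp.finite_inversions {w : Equiv.Perm ℕ+} (hw : FinSupp w) :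
    (inversions w).Finite := by
  obtain ⟨N, hN⟩ := hw.bddAbove
  have hfix : ∀ x, N < x → w x = x := fun x hx => by
    by_contra h
    exact absurd (hN h) (not_le.2 hx)
  refine ((Set.finite_Iic N).prod (Set.finite_Iic N)).subset ?_
  rintro ⟨i, j⟩ ⟨hij, hw⟩
  simp only at hij hw
  have hj : j ≤ N := by
    by_contra! h
    rw [hfix j h] at hw
    have := w.injective (hfix (w i) (h.trans hw))
    exact absurd (this ▸ hw) (not_lt.2 hij.le)
  exact ⟨hij.le.trans hj, hj⟩

theorem FinSupp.mul_swap {w : Equiv.Perm ℕ+} (hw : FinSupp w) (a b : ℕ+) :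
    FinSupp (w * Equiv.swap a b) := by
  refine (hw.union ((Set.finite_singleton a).insert b)).subset ?_
  intro x hx
  by_contra h
  simp only [Set.mem_union, Set.mem_ofPred_eq, Set.mem_insert_iff, Set.mem_singleton_iff,
    not_or, not_not] at h
  apply hx
  rw [Equiv.Perm.mul_apply, Equiv.swap_apply_of_ne_of_ne h.2.2 h.2.1, h.1]

theorem finSupp_of_fixes {n : ℕ+} {w : Equiv.Perm ℕ+} (hw : ∀ i, n < i → w i = i) :
    FinSupp w := by
  refine (Set.finite_Iic n).subset fun x hx => ?_
  by_contra h
  exact hx (hw x (not_le.1 h))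

/-- Apply the transposition `(a,b)` to both entries of an increasing pair, unless this would
reverse their order. -/
def swapPair (a b : ℕ+) (p : ℕ+ × ℕ+) : ℕ+ × ℕ+ :=
  if Equiv.swap a b p.1 < Equiv.swap a b p.2 then (Equiv.swap a b p.1, Equiv.swap a b p.2) else p

theorem swapPair_swapPair {a b : ℕ+} {p : ℕ+ × ℕ+} (hp : p.1 < p.2) :
    swapPair a b (swapPair a b p) = p := by
  by_cases h : Equiv.swap a b p.1 < Equiv.swap a b p.2
  · simp [swapPair, h, hp]
  · simp [swapPair, h]

theorem swapPair_mem_inversions {u : Equiv.Perm ℕ+} {a b : ℕ+} (hab : a < b) (hu : u a < u b)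
    {p : ℕ+ × ℕ+} (hp : p ∈ inversions u) :
    swapPair a b p ∈ inversions (u * Equiv.swap a b) := by
  obtain ⟨i, j⟩ := p
  obtain ⟨hij, hinv⟩ := hp
  simp only at hij hinv
  by_cases h : Equiv.swap a b i < Equiv.swap a b j
  · simp [swapPair, h, inversions, hinv]
  · simp only [swapPair, h, if_false, inversions, Set.mem_ofPred_eq, hij, true_and,
      Equiv.Perm.mul_apply]
    simp only [Equiv.swap_apply_def] at h ⊢
    split_ifs at h ⊢ <;> subst_vars <;> order

theorem mem_inversions_mul_swap {u : Equiv.Perm ℕ+} {a b : ℕ+} (hab : a < b)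
    (hbetween : ∀ c, a < c → c < b → u a < u c → ¬ u c < u b)
    {p : ℕ+ × ℕ+} (hp : p ∈ inversions (u * Equiv.swap a b)) (hne : p ≠ (a, b)) :
    swapPair a b p ∈ inversions u := by
  obtain ⟨i, j⟩ := p
  obtain ⟨hij, hinv⟩ := hp
  simp only [Equiv.Perm.mul_apply] at hij hinv
  by_cases h : Equiv.swap a b i < Equiv.swap a b j
  · simp [swapPair, h, inversions, hinv]
  · simp only [swapPair, h, if_false, inversions, Set.mem_ofPred_eq, hij, true_and]
    have hlt : ∀ c d, c ≠ d → u c < u d ∨ u d < u c := fun c d hcd =>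
      lt_or_gt_of_ne (u.injective.ne hcd)
    have hi := hbetween i
    have hj := hbetween j
    have := hlt a i
    have := hlt a j
    have := hlt b i
    have := hlt b j
    simp only [Equiv.swap_apply_def] at h hinv
    grind

theorem len_add_one_le_len_mul_swap {u : Equiv.Perm ℕ+} (hfin : FinSupp u) {a b : ℕ+}
    (hab : a < b) (hu : u a < u b) : len u + 1 ≤ len (u * Equiv.swap a b) ∧
    ((∃ c, a < c ∧ c < b ∧ u a < u c ∧ u c < u b) → len u + 2 ≤ len (u * Equiv.swap a b)) ∧
    ((∀ c, a < c → c < b → u a < u c → ¬ u c < u b) → len (u * Equiv.swap a b) = len u + 1) := by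
  have hfin' := (hfin.mul_swap a b).finite_inversions
  have hinj : Set.InjOn (swapPair a b) (inversions u) := fun p hp q hq h => by
    rw [← swapPair_swapPair (a := a) (b := b) hp.1, h, swapPair_swapPair hq.1]
  have hcard : (swapPair a b '' inversions u).ncard = len u := hinj.ncard_image
  have himfin : (swapPair a b '' inversions u).Finite := hfin.finite_inversions.image _
  have hsub : swapPair a b '' inversions u ⊆ inversions (u * Equiv.swap a b) := by
    rintro _ ⟨p, hp, rfl⟩
    exact swapPair_mem_inversions hab hu hp
  have hmem : (a, b) ∈ inversions (u * Equiv.swap a b) := by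
    simp [inversions, hab, hu]
  have hnotMem : ∀ c, a < c → c ≤ b → u a < u c → (a, c) ∉ swapPair a b '' inversions u := by
    rintro c hac hcb huc ⟨p, hp, hpc⟩
    have hpc' : p = (a, c) := by
      rw [← swapPair_swapPair (a := a) (b := b) hp.1, hpc, swapPair, if_neg]
      simp only [Equiv.swap_apply_left]
      rcases hcb.eq_or_lt with rfl | hcb
      · simpa using hab.le
      · rw [Equiv.swap_apply_of_ne_of_ne hac.ne' hcb.ne]
        exact not_lt.2 hcb.le
    rw [hpc'] at hp
    exact absurd hp.2 (not_lt.2 huc.le)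
  have hins : (insert (a, b) (swapPair a b '' inversions u)).ncard = len u + 1 := by
    rw [Set.ncard_insert_of_notMem (hnotMem b hab le_rfl hu) himfin, hcard]
  refine ⟨?_, ?_, ?_⟩
  · rw [← hins]
    exact Set.ncard_le_ncard (Set.insert_subset hmem hsub) hfin'
  · rintro ⟨c, hac, hcb, huac, hucb⟩
    have hc : (a, c) ∉ insert (a, b) (swapPair a b '' inversions u) := by
      rintro (h | h)
      · exact hcb.ne (Prod.ext_iff.1 h).2
      · exact hnotMem c hac hcb.le huac h
    have hcmem : (a, c) ∈ inversions (u * Equiv.swap a b) := by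
      simp [inversions, hac, Equiv.swap_apply_of_ne_of_ne hac.ne' hcb.ne, hucb]
    have := Set.ncard_insert_of_notMem hc (himfin.insert _)
    rw [hins] at this
    rw [show len u + 2 = len u + 1 + 1 from rfl, ← this]
    exact Set.ncard_le_ncard
      (Set.insert_subset hcmem (Set.insert_subset hmem hsub)) hfin'
  · intro hbetween
    rw [← hins]
    refine congrArg Set.ncard (Set.Subset.antisymm (fun p hp => ?_)
      (Set.insert_subset hmem hsub))
    by_cases hne : p = (a, b)
    · exact Or.inl hne
    · exact Or.inr ⟨_, mem_inversions_mul_swap hab hbetween hp hne, swapPair_swapPair hp.1⟩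

/-- Local characterization of the covers of the Bruhat order. -/
theorem len_mul_swap_eq_iff {u : Equiv.Perm ℕ+} (hfin : FinSupp u) {a b : ℕ+} (hab : a < b) :
    len (u * Equiv.swap a b) = len u + 1 ↔
      u a < u b ∧ ∀ c, a < c → c < b → u a < u c → ¬ u c < u b := by
  constructor
  · intro h
    have hu : u a < u b := by
      by_contra! hle
      have hlt : u b < u a := lt_of_le_of_ne hle (fun h => hab.ne' (u.injective h))
      have := (len_add_one_le_len_mul_swap (hfin.mul_swap a b) hab (by simpa using hlt)).1
      rw [mul_assoc, Equiv.swap_mul_self, mul_one] at this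
      omega
    refine ⟨hu, fun c hac hcb huac hucb => ?_⟩
    have := (len_add_one_le_len_mul_swap hfin hab hu).2.1 ⟨c, hac, hcb, huac, hucb⟩
    omega
  · rintro ⟨hu, hbetween⟩
    exact (len_add_one_le_len_mul_swap hfin hab hu).2.2 hbetween

theorem kBruhatCov.finSupp_s15 {k : ℕ+} {x y : Equiv.Perm ℕ+} (h : kBruhatCov k x y)
    (hx : FinSupp x) : FinSupp y := by
  obtain ⟨a, b, -, -, rfl, -⟩ := h
  exact hx.mul_swap a b

theorem kBruhatCov.le_iff {k : ℕ+} {x y : Equiv.Perm ℕ+} (h : kBruhatCov k x y)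
    (hx : FinSupp x) (p : ℕ+) : (p ≤ k → x p ≤ y p) ∧ (k < p → y p ≤ x p) := by
  obtain ⟨a, b, ha, hb, rfl, hlen⟩ := h
  have hab := ha.trans_lt hb
  have hu := ((len_mul_swap_eq_iff hx hab).1 hlen).1
  simp only [Equiv.Perm.mul_apply, Equiv.swap_apply_def]
  grind

/-- Along the `k`-Bruhat order, values in positions at most `k` increase and the others
decrease. -/
theorem kBruhat.monotone {k : ℕ+} {x y : Equiv.Perm ℕ+} (h : kBruhat k x y)
    (hx : FinSupp x) (p : ℕ+) : (p ≤ k → x p ≤ y p) ∧ (k < p → y p ≤ x p) := by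
  induction h using Relation.ReflTransGen.head_induction_on with
  | refl => exact ⟨fun _ => le_rfl, fun _ => le_rfl⟩
  | head hxy _ ih =>
    have h₁ := hxy.le_iff hx p
    have h₂ := ih (hxy.finSupp_s15 hx)
    exact ⟨fun hp => (h₁.1 hp).trans (h₂.1 hp), fun hp => (h₂.2 hp).trans (h₁.2 hp)⟩

/-- The order-reversing involution of the first `n` positive integers. -/
def IsReversal (n : ℕ+) (w : Equiv.Perm ℕ+) : Prop :=
  ∀ i : ℕ+, (i ≤ n → w i = n + 1 - i) ∧ (n < i → w i = i)

namespace IsReversal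

variable {n : ℕ+} {w : Equiv.Perm ℕ+}

theorem coe_add (hw : IsReversal n w) {i : ℕ+} (hi : i ≤ n) : (w i : ℕ) + i = n + 1 := by
  have hlt : i < n + 1 := PNat.lt_add_one_iff.2 hi
  rw [(hw i).1 hi, add_comm]
  exact_mod_cast congrArg PNat.val (PNat.add_sub_of_lt hlt)

theorem apply_le (hw : IsReversal n w) {i : ℕ+} (hi : i ≤ n) : w i ≤ n := by
  have := hw.coe_add hi
  have := i.pos
  rw [← PNat.coe_le_coe]
  omega

theorem strictAntiOn (hw : IsReversal n w) : StrictAntiOn w (Set.Iic n) := by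
  intro i hi j hj hij
  have := hw.coe_add hi
  have := hw.coe_add hj
  rw [← PNat.coe_lt_coe] at *
  omega

theorem apply_apply (hw : IsReversal n w) (i : ℕ+) : w (w i) = i := by
  rcases le_or_gt i n with hi | hi
  · have := hw.coe_add hi
    have := hw.coe_add (hw.apply_le hi)
    apply PNat.eq
    omega
  · rw [(hw i).2 hi, (hw i).2 hi]

theorem mul_self (hw : IsReversal n w) : w * w = 1 :=
  Equiv.ext hw.apply_apply

theorem conj_fixes (hw : IsReversal n w) {η : Equiv.Perm ℕ+} (hη : ∀ i, n < i → η i = i)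
    (i : ℕ+) (hi : n < i) : (w * η * w) i = i := by
  simp [(hw i).2 hi, hη i hi]

theorem conj_conj (hw : IsReversal n w) (η : Equiv.Perm ℕ+) : w * (w * η * w) * w = η := by
  rw [show w * (w * η * w) * w = (w * w) * η * (w * w) by simp only [mul_assoc], hw.mul_self,
    one_mul, mul_one]

end IsReversal

theorem apply_le_of_fixes {n : ℕ+} {w : Equiv.Perm ℕ+} (hw : ∀ i, n < i → w i = i) {i : ℕ+}
    (hi : i ≤ n) : w i ≤ n := by
  by_contra! h
  exact absurd (w.injective (hw _ h) ▸ h) (not_lt.2 hi)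

/-- Any permutation can be sorted into decreasing order on its first `n` positions. -/
theorem exists_strictAntiOn (n : ℕ+) (g : Equiv.Perm ℕ+) :
    ∃ v : Equiv.Perm ℕ+, (∀ i, n < i → v i = i) ∧ StrictAntiOn (g * v) (Set.Iic n) := by
  let e : Fin n ≃ {x : ℕ+ // x ≤ n} :=
    { toFun := fun i => ⟨i.val.succPNat, Nat.succ_le_of_lt i.isLt⟩
      invFun := fun x => ⟨x.1.natPred, by
        have := x.1.natPred_add_one
        have : (x.1 : ℕ) ≤ n := x.2
        omega⟩
      left_inv := fun i => by simp
      right_inv := fun x => by simp }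
  let f : Fin n → ℕ+ᵒᵈ := fun i => OrderDual.toDual (g (e i))
  let s := Tuple.sort f
  have hs : Monotone (f ∘ s) := Tuple.monotone_sort f
  refine ⟨s.extendDomain e, fun i hi => s.extendDomain_apply_not_subtype e (not_le.2 hi), ?_⟩
  intro i hi j hj hij
  have hle : g (s.extendDomain e j) ≤ g (s.extendDomain e i) := by
    rw [s.extendDomain_apply_subtype e hi, s.extendDomain_apply_subtype e hj]
    refine hs (?_ : e.symm ⟨i, hi⟩ ≤ e.symm ⟨j, hj⟩)
    exact Nat.sub_le_sub_right (PNat.coe_le_coe _ _ |>.2 hij.le) 1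
  exact lt_of_le_of_ne hle fun h => hij.ne' ((s.extendDomain e).injective (g.injective h))

/-- A threshold separating the positions of large values of a decreasing sequence from those
of small values. -/
theorem StrictAntiOn.exists_threshold {n : ℕ+} {f : Equiv.Perm ℕ+}
    (hf : StrictAntiOn f (Set.Iic n)) (k : ℕ+) :
    ∃ k' : ℕ+, ∀ i j, i ≤ n → j ≤ n → f i ≤ k → k < f j → j ≤ k' ∧ k' < i := by
  have hfin : {j | j ≤ n ∧ k < f j}.Finite := (Set.finite_Iic n).subset fun _ h => h.1
  rcases Set.eq_empty_or_nonempty {j | j ≤ n ∧ k < f j} with h | h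
  · exact ⟨1, fun i j _ hj _ hkj => (Set.eq_empty_iff_forall_notMem.1 h j ⟨hj, hkj⟩).elim⟩
  · obtain ⟨m, ⟨hm, hkm⟩, hmax⟩ := Set.exists_max_image _ id hfin h
    refine ⟨m, fun i j hi hj hik hkj => ⟨hmax j ⟨hj, hkj⟩, ?_⟩⟩
    by_contra! him
    exact absurd (hkm.trans_le (hf.antitoneOn hi hm him)) (not_lt.2 hik)

section Transfer

variable {n k k' : ℕ+} {w u f : Equiv.Perm ℕ+}

/-- Values at most `n` stay so if all the larger ones are in the same positions. -/
theorem apply_le_of_agree {x : Equiv.Perm ℕ+} (hx : ∀ q, n < u q → x q = u q) {q : ℕ+}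
    (hq : u q ≤ n) : x q ≤ n := by
  by_contra! h
  have h₁ := hx (u⁻¹ (x q)) (by simpa using h)
  have h₂ : u⁻¹ (x q) = q := x.injective (by simpa using h₁)
  have h₃ : x q = u q := by simpa using congrArg u h₂
  exact absurd (h₃ ▸ h) (not_lt.2 hq)

theorem kBruhatCov.transfer (hw : IsReversal n w) (hf : StrictAntiOn f (Set.Iic n))
    (hfu : ∀ i, i ≤ n ↔ u (f i) ≤ n)
    (hk : ∀ i j, i ≤ n → j ≤ n → f i ≤ k → k < f j → j ≤ k' ∧ k' < i)
    {x y : Equiv.Perm ℕ+} (hxfin : FinSupp x) (hxfin' : FinSupp (w * x * f))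
    (hx : ∀ q, n < u q → x q = u q) (hy : ∀ q, n < u q → y q = u q)
    (h : kBruhatCov k x y) : kBruhatCov k' (w * x * f) (w * y * f) := by
  obtain ⟨a, b, ha, hb, rfl, hlen⟩ := h
  have hab := ha.trans_lt hb
  have hua : u a ≤ n := by
    by_contra! h
    have := (hy a h).trans (hx a h).symm
    simp only [Equiv.Perm.mul_apply, Equiv.swap_apply_left] at this
    exact hab.ne' (x.injective this)
  have hub : u b ≤ n := by
    by_contra! h
    have := (hy b h).trans (hx b h).symm
    simp only [Equiv.Perm.mul_apply, Equiv.swap_apply_right] at this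
    exact hab.ne (x.injective this)
  obtain ⟨i, rfl⟩ := f.surjective a
  obtain ⟨j, rfl⟩ := f.surjective b
  have hi := (hfu i).2 hua
  have hj := (hfu j).2 hub
  have hji : j < i := (hf.lt_iff_gt hi hj).1 hab
  obtain ⟨hu, hbetween⟩ := (len_mul_swap_eq_iff hxfin hab).1 hlen
  have hkij := hk i j hi hj ha hb
  have heq : w * (x * Equiv.swap (f i) (f j)) * f = w * x * f * Equiv.swap j i := by
    rw [Equiv.swap_comm j i, Equiv.swap_apply_apply]
    simp only [mul_assoc, inv_mul_cancel, mul_one]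
  have hle : ∀ c, c ≤ n → x (f c) ≤ n := fun c hc => apply_le_of_agree hx ((hfu c).1 hc)
  refine ⟨j, i, hkij.1, hkij.2, heq, ?_⟩
  rw [heq, len_mul_swap_eq_iff hxfin' hji]
  refine ⟨hw.strictAntiOn (hle i hi) (hle j hj) hu, fun c hjc hci h₁ h₂ => ?_⟩
  have hc := hci.le.trans hi
  exact hbetween (f c) (hf hc hi hci) (hf hj hc hjc)
    ((hw.strictAntiOn.lt_iff_gt (hle c hc) (hle i hi)).1 h₂)
    ((hw.strictAntiOn.lt_iff_gt (hle j hj) (hle c hc)).1 h₁)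

theorem kBruhat.transfer (hw : IsReversal n w) (hf : StrictAntiOn f (Set.Iic n))
    (hfu : ∀ i, i ≤ n ↔ u (f i) ≤ n)
    (hk : ∀ i j, i ≤ n → j ≤ n → f i ≤ k → k < f j → j ≤ k' ∧ k' < i)
    {x z : Equiv.Perm ℕ+} (h : kBruhat k x z) (hxfin : FinSupp x) (hxfin' : FinSupp (w * x * f))
    (hx : ∀ q, n < u q → x q = u q) (hz : ∀ q, n < u q → z q = u q) :
    kBruhat k' (w * x * f) (w * z * f) := by
  induction h using Relation.ReflTransGen.head_induction_on with
  | refl => exact Relation.ReflTransGen.refl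
  | @head x y hxy hyz ih =>
    have hyfin := hxy.finSupp_s15 hxfin
    have hy : ∀ q, n < u q → y q = u q := fun q hq => by
      have h₁ := hxy.le_iff hxfin q
      have h₂ := kBruhat.monotone hyz hyfin q
      rw [hx q hq] at h₁
      rw [hz q hq] at h₂
      rcases le_or_gt q k with hqk | hqk
      · exact le_antisymm (h₂.1 hqk) (h₁.1 hqk)
      · exact le_antisymm (h₁.2 hqk) (h₂.2 hqk)
    have hcov := hxy.transfer hw hf hfu hk hxfin hxfin' hx hy
    exact Relation.ReflTransGen.head hcov (ih hyfin (hcov.finSupp_s15 hxfin') hy)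

end Transfer

theorem NewOrder.conj {n : ℕ+} {w η ζ : Equiv.Perm ℕ+} (hw : IsReversal n w)
    (hη : ∀ i, n < i → η i = i) (hζ : ∀ i, n < i → ζ i = i) (h : NewOrder η ζ) :
    NewOrder (w * η * w) (w * ζ * w) := by
  obtain ⟨u, k, hu, h₁, h₂⟩ := h
  obtain ⟨v, hv, hf⟩ := exists_strictAntiOn n (u⁻¹ * w)
  obtain ⟨k', hk⟩ := hf.exists_threshold k
  have hfu : ∀ i, i ≤ n ↔ u ((u⁻¹ * w * v) i) ≤ n := fun i => by
    have : u ((u⁻¹ * w * v) i) = w (v i) := by simp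
    rw [this]
    refine ⟨fun hi => hw.apply_le (apply_le_of_fixes hv hi), fun h => ?_⟩
    by_contra! hi
    rw [hv i hi, (hw i).2 hi] at h
    exact absurd hi (not_lt.2 h)
  have hconj : ∀ θ : Equiv.Perm ℕ+, w * (θ * u) * (u⁻¹ * w * v) = w * θ * w * v := fun θ => by
    group
  have hbase : w * u * (u⁻¹ * w * v) = v := by
    rw [show w * u * (u⁻¹ * w * v) = w * w * v by group, hw.mul_self, one_mul]
  have hηu : ∀ q, n < u q → (η * u) q = u q := fun q hq => hη _ hq
  have hζu : ∀ q, n < u q → (ζ * u) q = u q := fun q hq => hζ _ hq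
  have hηfin : FinSupp (η * u) :=
    (hu.union (finSupp_of_fixes hη)).subset fun q hq => by
      by_contra h
      simp only [Set.mem_union, Set.mem_ofPred_eq, not_or, not_not] at h
      exact hq (by rw [Equiv.Perm.mul_apply, h.1, h.2])
  have hηfin' : FinSupp (w * η * w * v) :=
    finSupp_of_fixes (n := n) fun i hi => by
      rw [Equiv.Perm.mul_apply, hv i hi, hw.conj_fixes hη i hi]
  refine ⟨v, k', finSupp_of_fixes hv, ?_, ?_⟩
  · have := h₁.transfer hw hf hfu hk hu (hbase.symm ▸ finSupp_of_fixes hv) (fun _ _ => rfl) hηu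
    rwa [hbase, hconj] at this
  · have := h₂.transfer hw hf hfu hk hηfin ((hconj η).symm ▸ hηfin') hηu hζu
    rwa [hconj, hconj] at this

/-- Let `w₀ ∈ S_∞` be the longest element of `S_n`: `w₀ i = n + 1 - i` for
`i ≤ n` and `w₀ i = i` for `i > n`.  For `η, ζ ∈ S_n` (permutations fixing all
`i > n`) one has `η ⪯ ζ ↔ w₀ηw₀ ⪯ w₀ζw₀`; that is, conjugation by `w₀` is an
automorphism of `(S_n, ⪯)`. -/
theorem stmt_15 (n : ℕ+) (w₀ : Equiv.Perm ℕ+)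
    (hw₀ : ∀ i : ℕ+, (i ≤ n → w₀ i = n + 1 - i) ∧ (n < i → w₀ i = i))
    (η ζ : Equiv.Perm ℕ+)
    (hη : ∀ i : ℕ+, n < i → η i = i) (hζ : ∀ i : ℕ+, n < i → ζ i = i) :
    NewOrder η ζ ↔ NewOrder (w₀ * η * w₀) (w₀ * ζ * w₀) := by
  have hw : IsReversal n w₀ := hw₀
  refine ⟨NewOrder.conj hw hη hζ, fun h => ?_⟩
  have := NewOrder.conj hw (hw.conj_fixes hη) (hw.conj_fixes hζ) h
  rwa [hw.conj_conj, hw.conj_conj] at this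
end
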